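/- Let (P, α) be a maximal (p,q)-pair of rank d. If p ≥ 2d, then P is a regular p-group. -/

import Mathlib

/-- The minimal number of generators of a group. -/
noncomputable def dG (G : Type*) [Group G] : ℕ :=
  sInf {n | ∃ S : Finset G, S.card = n ∧ Subgroup.closure (S : Set G) = ⊤}

/-- A maximal `(p,q)`-pair of rank `d`. -/
def IsMaximalPair (p q d : ℕ) (P : Type*) [Group P] (α : P ≃* P) : Prop :=
  p.Prime ∧ q.Prime ∧ Finite P ∧ IsPGroup p P ∧ orderOf α = q ∧ q ∣ p - 1 ∧
  dG P = d ∧ (∀ H : Subgroup P, dG H ≤ d) ∧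
  (∃ k : ℤ, ¬ ((p : ℤ) ∣ k - 1) ∧ ∀ x : P, α x * (x ^ k)⁻¹ ∈ frattini P) ∧
  (∀ H : Subgroup P, H ≠ ⊤ → dG H = d →
    H.map α.toMonoidHom ≠ H ∨
      ¬ ∃ k : ℤ, ¬ ((p : ℤ) ∣ k - 1) ∧
        ∀ x : H, α (x : P) * ((x : P) ^ k)⁻¹ ∈ (frattini H).map H.subtype)

/-- A finite `p`-group is regular if for all `x, y`, `(xy)^p ≡ x^p y^p` modulo the
subgroup generated by the `p`-th powers of elements of the derived subgroup of `⟨x, y⟩`. -/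
def IsRegularPGroup (p : ℕ) (P : Type*) [Group P] : Prop :=
  ∀ x y : P,
    (x * y) ^ p * (x ^ p * y ^ p)⁻¹ ∈
      Subgroup.closure ((· ^ p) ''
        (⁅Subgroup.closure {x, y}, Subgroup.closure {x, y}⁆ : Subgroup P))

section Aux

open scoped commutatorElement

/-- `[N, K, ..., K]` with `n` copies of the whole group. -/
def serN {K : Type*} [Group K] (N : Subgroup K) : ℕ → Subgroup K
  | 0 => N
  | n + 1 => ⁅serN N n, (⊤ : Subgroup K)⁆

theorem serN_normal {K : Type*} [Group K] (N : Subgroup K) [hN : N.Normal] (n : ℕ) :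
    (serN N n).Normal := by
  induction n with
  | zero => exact hN
  | succ n ih => have := ih; rw [serN]; infer_instance

theorem serN_succ_le {K : Type*} [Group K] (N : Subgroup K) [N.Normal] (n : ℕ) :
    serN N (n + 1) ≤ serN N n := by
  have := serN_normal N n
  exact Subgroup.commutator_le_left _ _

theorem serN_anti {K : Type*} [Group K] (N : Subgroup K) [N.Normal] : Antitone (serN N) :=
  antitone_nat_of_succ_le (serN_succ_le N)

theorem serN_mono {K : Type*} [Group K] {N M : Subgroup K} (h : N ≤ M) (n : ℕ) :
    serN N n ≤ serN M n := by
  induction n with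
  | zero => exact h
  | succ n ih => exact Subgroup.commutator_mono ih le_rfl

theorem serN_add {K : Type*} [Group K] (N : Subgroup K) (m n : ℕ) :
    serN N (m + n) = serN (serN N m) n := by
  induction n with
  | zero => rfl
  | succ n ih => rw [← Nat.add_assoc, serN, serN, ih]

theorem three_subgroups {K : Type*} [Group K] (A B C N : Subgroup K) [N.Normal]
    (h1 : ⁅⁅B, C⁆, A⁆ ≤ N) (h2 : ⁅⁅C, A⁆, B⁆ ≤ N) : ⁅⁅A, B⁆, C⁆ ≤ N := by
  have key : ∀ H : Subgroup K, H ≤ N ↔ H.map (QuotientGroup.mk' N) = ⊥ := by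
    intro H
    rw [Subgroup.map_eq_bot_iff, QuotientGroup.ker_mk']
  rw [key] at *
  rw [Subgroup.map_commutator, Subgroup.map_commutator] at *
  exact Subgroup.commutator_commutator_eq_bot_of_rotate h1 h2

theorem serN_comm {K : Type*} [Group K] (N : Subgroup K) [N.Normal] (j : ℕ) :
    ∀ i, ⁅serN N i, serN (⊤ : Subgroup K) j⁆ ≤ serN N (i + j + 1) := by
  induction j with
  | zero => intro i; exact le_rfl
  | succ j ih =>
    intro i
    have := serN_normal N (i + (j + 1) + 1)
    rw [Subgroup.commutator_comm]
    refine three_subgroups (serN ⊤ j) ⊤ (serN N i) _ ?_ ?_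
    · rw [Subgroup.commutator_comm ⊤]
      have := ih (i + 1)
      rw [show i + (j + 1) + 1 = i + 1 + j + 1 by omega]
      exact this
    · have := ih i
      exact Subgroup.commutator_mono this le_rfl

/-- A filtration of a group. -/
structure Filt (X : Type*) [Group X] where
  F : ℕ → Subgroup X
  anti : Antitone F
  comm : ∀ s t, ∀ g ∈ F s, ∀ h ∈ F t, ⁅g, h⁆ ∈ F (s + t)

theorem Filt.conj {X : Type*} [Group X] (A : Filt X) {m t : ℕ} {a h : X} (ha : a ∈ A.F m)
    (hh : h ∈ A.F t) : h * a * h⁻¹ ∈ A.F m := by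
  have h1 : ⁅h, a⁆ ∈ A.F m := A.anti (Nat.le_add_left m t) (A.comm t m h hh a ha)
  have h2 := (A.F m).mul_mem h1 ha
  simpa [commutatorElement_def] using h2

theorem Filt.conj' {X : Type*} [Group X] (A : Filt X) {m t : ℕ} {a h : X} (ha : a ∈ A.F m)
    (hh : h ∈ A.F t) : h⁻¹ * a * h ∈ A.F m := by
  simpa using A.conj ha ((A.F t).inv_mem hh)

/-- The refined filtration given by one more discrete derivative. -/
def Filt.next {X : Type*} [Group X] (σ : X →* X) (A : Filt X) : Filt X where
  F s :=
    { carrier := {g | g ∈ A.F s ∧ g⁻¹ * σ g ∈ A.F (s + 1)}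
      one_mem' := by simp [one_mem]
      mul_mem' := by
        rintro g h ⟨hg, hg'⟩ ⟨hh, hh'⟩
        refine ⟨mul_mem hg hh, ?_⟩
        have := mul_mem (A.conj' hg' hh) hh'
        convert this using 1
        simp only [map_mul]; group
      inv_mem' := by
        rintro g ⟨hg, hg'⟩
        refine ⟨inv_mem hg, ?_⟩
        have := A.conj (inv_mem hg') hg
        convert this using 1
        simp only [map_inv]; group }
  anti := by
    intro s t hst g hg
    exact ⟨A.anti hst hg.1, A.anti (by omega) hg.2⟩
  comm := by
    rintro s t g ⟨hg, hg'⟩ h ⟨hh, hh'⟩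
    refine ⟨A.comm s t g hg h hh, ?_⟩
    have e1 : ⁅g⁻¹ * σ g, h * (h⁻¹ * σ h)⁆ ∈ A.F (s + t + 1) := by
      have := A.comm (s + 1) t _ hg' (h * (h⁻¹ * σ h))
        (mul_mem hh (A.anti (Nat.le_succ t) hh'))
      rwa [show s + 1 + t = s + t + 1 by omega] at this
    have e2 : ⁅g, h⁻¹ * σ h⁆ ∈ A.F (s + t + 1) := A.comm s (t + 1) g hg _ hh'
    have := mul_mem (A.conj' (A.conj e1 hg) (A.comm s t g hg h hh)) (A.conj e2 hh)
    convert this using 1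
    simp only [commutatorElement_def, map_mul, map_inv]; group

/-- The filtration of the sequence group coming from the lower central series. -/
def baseFilt (G : Type*) [Group G] : Filt (ℕ → G) where
  F s :=
    { carrier := {g | ∀ n, g n ∈ serN (⊤ : Subgroup G) (s - 1)}
      one_mem' := by intro n; exact one_mem _
      mul_mem' := by intro g h hg hh n; exact mul_mem (hg n) (hh n)
      inv_mem' := by intro g hg n; exact inv_mem (hg n) }
  anti := by
    intro s t hst g hg n
    exact serN_anti ⊤ (by omega) (hg n)
  comm := by
    intro s t g hg h hh n
    have := serN_normal (⊤ : Subgroup G) (s - 1)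
    have := serN_normal (⊤ : Subgroup G) (t - 1)
    have hm := Subgroup.commutator_mem_commutator (hg n) (hh n)
    change ⁅g n, h n⁆ ∈ _
    rcases Nat.eq_zero_or_pos s with rfl | hs
    · have := Subgroup.commutator_le_right _ _ hm
      simpa using this
    rcases Nat.eq_zero_or_pos t with rfl | ht
    · have := Subgroup.commutator_le_left _ _ hm
      simpa using this
    · have := serN_comm ⊤ _ _ hm
      rwa [show s - 1 + (t - 1) + 1 = s + t - 1 by omega] at this

/-- The shift endomorphism on sequences. -/
def shiftHom (G : Type*) [Group G] : (ℕ → G) →* (ℕ → G) where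
  toFun f := fun n => f (n + 1)
  map_one' := rfl
  map_mul' _ _ := rfl

/-- Iterated refinement: `k`-fold derivatives. -/
def polyFilt (G : Type*) [Group G] : ℕ → Filt (ℕ → G)
  | 0 => baseFilt G
  | k + 1 => (polyFilt G k).next (shiftHom G)

theorem mem_polyFilt_succ {G : Type*} [Group G] {k s : ℕ} {f : ℕ → G} :
    f ∈ (polyFilt G (k + 1)).F s ↔ f ∈ (polyFilt G k).F s ∧
      (fun n => (f n)⁻¹ * f (n + 1)) ∈ (polyFilt G k).F (s + 1) := Iff.rfl

theorem choose_mem_polyFilt {G : Type*} [Group G] (k : ℕ) : ∀ (s j : ℕ) (c : G),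
    c ∈ serN (⊤ : Subgroup G) (s + j - 1) →
    (fun n : ℕ => c ^ n.choose j) ∈ (polyFilt G k).F s := by
  induction k with
  | zero =>
    intro s j c hc n
    exact pow_mem (serN_anti ⊤ (by omega) hc) _
  | succ k ih =>
    intro s j c hc
    refine mem_polyFilt_succ.2 ⟨ih s j c hc, ?_⟩
    cases j with
    | zero =>
      simp only [Nat.choose_zero_right, pow_one, inv_mul_cancel]
      exact one_mem _
    | succ j =>
      have := ih (s + 1) j c (by rwa [show s + 1 + j - 1 = s + (j + 1) - 1 by omega])
      convert this using 2 with n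
      rw [Nat.choose_succ_succ, Nat.add_comm (n.choose j), pow_add, inv_mul_cancel_left]

theorem polyFilt_value {G : Type*} [Group G] (i : ℕ) : ∀ (s : ℕ) (f : ℕ → G),
    f ∈ (polyFilt G i).F s → (∀ n < i, f n = 1) → f i ∈ serN (⊤ : Subgroup G) (s + i - 1) := by
  induction i with
  | zero => intro s f hf _; exact hf 0
  | succ i ih =>
    intro s f hf h1
    have h2 := ih (s + 1) _ (mem_polyFilt_succ.1 hf).2 (by
      intro n hn
      simp [h1 n (by omega), h1 (n + 1) (by omega)])
    simp only [h1 i (by omega), inv_one, one_mul] at h2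
    rwa [show s + 1 + i - 1 = s + (i + 1) - 1 by omega] at h2

theorem mul_pow_of_class_lt {G : Type*} [Group G] (p : ℕ) (hp : p.Prime)
    (hcl : serN (⊤ : Subgroup G) (p - 1) = ⊥)
    (hexp : ∀ c ∈ commutator G, c ^ p = 1) (x y : G) : (x * y) ^ p = x ^ p * y ^ p := by
  have hpw : ∀ k (z : G), (fun n : ℕ => z ^ n) ∈ (polyFilt G k).F 0 := by
    intro k z
    simpa using choose_mem_polyFilt k 0 1 z (by simp [serN])
  have key : ∀ i, 2 ≤ i → i ≤ p → ∃ f : ℕ → G, (∀ k, f ∈ (polyFilt G k).F 0) ∧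
      (∀ n < i, f n = 1) ∧ f p = (x * y) ^ p * (y ^ p)⁻¹ * (x ^ p)⁻¹ := by
    intro i hi
    induction i, hi using Nat.le_induction with
    | base =>
      intro _
      refine ⟨fun n => (x * y) ^ n * (y ^ n)⁻¹ * (x ^ n)⁻¹, fun k => ?_, ?_, rfl⟩
      · exact mul_mem (mul_mem (hpw k _) (inv_mem (hpw k y))) (inv_mem (hpw k x))
      · intro n hn
        interval_cases n <;> simp
    | succ i hi ih =>
      intro hip
      obtain ⟨f, hf, h1, hfp⟩ := ih (by omega)
      have hc : f i ∈ serN (⊤ : Subgroup G) (0 + i - 1) := polyFilt_value i 0 f (hf i) h1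
      refine ⟨fun n => f n * (f i ^ n.choose i)⁻¹, fun k => ?_, ?_, ?_⟩
      · exact mul_mem (hf k) (inv_mem (choose_mem_polyFilt k 0 i _ hc))
      · intro n hn
        rcases Nat.lt_succ_iff_lt_or_eq.1 hn with h | rfl
        · simp [h1 n h, Nat.choose_eq_zero_of_lt h]
        · simp
      · have hc' : f i ∈ commutator G := by
          have : f i ∈ serN (⊤ : Subgroup G) 1 := serN_anti ⊤ (by omega) hc
          exact this
        obtain ⟨m, hm⟩ := hp.dvd_choose_self (by omega : i ≠ 0) (by omega : i < p)
        simp only [hm, pow_mul, hexp _ hc', one_pow, inv_one, mul_one, hfp]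
  obtain ⟨f, hf, h1, hfp⟩ := key p hp.two_le le_rfl
  have := polyFilt_value p 0 f (hf p) h1
  rw [Nat.zero_add, hcl, Subgroup.mem_bot, hfp, mul_inv_eq_one, mul_inv_eq_iff_eq_mul] at this
  exact this

/-- Every subgroup is generated by at most `d` elements. -/
def RankLE (d : ℕ) (G : Type*) [Group G] : Prop :=
  ∀ A : Subgroup G, ∃ S : Finset G, S.card ≤ d ∧ Subgroup.closure (S : Set G) = A

theorem RankLE.of_surjective {d : ℕ} {G K : Type*} [Group G] [Group K] (h : RankLE d G)
    (f : G →* K) (hf : Function.Surjective f) : RankLE d K := by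
  classical
  intro A
  obtain ⟨S, hS, hA⟩ := h (A.comap f)
  refine ⟨S.image f, Finset.card_image_le.trans hS, ?_⟩
  rw [Finset.coe_image, ← MonoidHom.map_closure, hA, Subgroup.map_comap_eq_self_of_surjective hf]

theorem RankLE.subgroup {d : ℕ} {G : Type*} [Group G] (h : RankLE d G) (H : Subgroup G) :
    RankLE d H := by
  classical
  intro A
  obtain ⟨S, hS, hA⟩ := h (A.map H.subtype)
  have hSH : ∀ s ∈ S, s ∈ H := by
    intro s hs
    have : s ∈ A.map H.subtype := hA ▸ Subgroup.subset_closure hs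
    obtain ⟨a, _, rfl⟩ := this
    exact a.2
  refine ⟨S.attach.image fun s => ⟨s.1, hSH s.1 s.2⟩,
    Finset.card_image_le.trans (by simpa using hS), ?_⟩
  apply Subgroup.map_injective H.subtype_injective
  rw [MonoidHom.map_closure, ← hA]
  congr 1
  ext x
  simp only [Finset.coe_image, Set.mem_image, Finset.mem_coe, Finset.mem_attach, true_and]
  constructor
  · rintro ⟨_, ⟨s, rfl⟩, rfl⟩
    exact s.2
  · intro hx
    exact ⟨_, ⟨⟨x, hx⟩, rfl⟩, rfl⟩

theorem card_le_of_rankLE {p d : ℕ} {G : Type*} [Group G] [Finite G] (hp : 0 < p)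
    (h : RankLE d G) (A : Subgroup G)
    (hab : ∀ a ∈ A, ∀ b ∈ A, a * b = b * a) (hexp : ∀ a ∈ A, a ^ p = 1) :
    Nat.card A ≤ p ^ d := by
  letI : CommGroup A :=
    { (inferInstance : Group A) with
      mul_comm := fun a b => Subtype.ext (hab a a.2 b b.2) }
  obtain ⟨S, hS, hA⟩ := h.subgroup A ⊤
  have h1 : Nat.card A ∣ p ^ Group.rank A :=
    card_dvd_exponent_pow_rank' A (fun g => Subtype.ext (hexp g g.2))
  have h2 : Group.rank A ≤ d := (Group.rank_le hA).trans hS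
  exact (Nat.le_of_dvd (pow_pos hp _) h1).trans (Nat.pow_le_pow_right hp h2)

theorem serN_eq_bot_of_card {p : ℕ} (hp : p.Prime) {K : Type*} [Group K] [Finite K]
    (hK : IsPGroup p K) (N : Subgroup K) [N.Normal] (d : ℕ) (hN : Nat.card N ≤ p ^ d) :
    serN N d = ⊥ := by
  have : Fact p.Prime := ⟨hp⟩
  have hnil : ∃ n, serN (⊤ : Subgroup K) n = ⊥ := by
    have := hK.isNilpotent
    obtain ⟨n, hn⟩ := Subgroup.nilpotent_iff_lowerCentralSeries.1 this
    refine ⟨n, ?_⟩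
    rw [← hn]
    clear hn
    induction n with
    | zero => rfl
    | succ n ih => rw [serN, ih]; rfl
  obtain ⟨c, hc⟩ := hnil
  have step : ∀ n, serN N n = ⊥ ∨ Nat.card (serN N n) * p ^ n ≤ p ^ d := by
    intro n
    induction n with
    | zero => right; simpa [serN] using hN
    | succ n ih =>
      by_cases hb : serN N (n + 1) = ⊥
      · exact Or.inl hb
      right
      have hb' : serN N n ≠ ⊥ := fun h => hb (by rw [serN, h]; simp)
      have ih := ih.resolve_left hb'
      have hle := serN_succ_le N n
      have hne : serN N (n + 1) ≠ serN N n := by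
        intro he
        have : ∀ m, serN N (n + m) = serN N n := by
          intro m
          induction m with
          | zero => rfl
          | succ m ihm => rw [← Nat.add_assoc, serN, ihm]; exact he
        have h1 := this c
        have h2 : serN N (n + c) ≤ ⊥ :=
          (serN_anti N (Nat.le_add_left c n)).trans ((serN_mono le_top c).trans hc.le)
        rw [h1] at h2
        exact hb' (le_bot_iff.1 h2)
      have hlt : Nat.card (serN N (n + 1)) ≠ Nat.card (serN N n) := fun h =>
        hne (Subgroup.eq_of_le_of_card_ge hle h.ge)
      obtain ⟨a, ha⟩ := (IsPGroup.iff_card.1 (hK.to_subgroup (serN N (n + 1))))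
      obtain ⟨b, hb2⟩ := (IsPGroup.iff_card.1 (hK.to_subgroup (serN N n)))
      have hd := Nat.le_of_dvd Nat.card_pos (Subgroup.card_dvd_of_le hle)
      rw [ha, hb2] at hlt hd
      rw [hb2] at ih
      rw [ha]
      have hab : a < b := by
        rcases (Nat.pow_le_pow_iff_right hp.one_lt).1 hd |>.lt_or_eq with h | h
        · exact h
        · exact absurd (by rw [h]) hlt
      refine le_trans ?_ ih
      rw [← pow_add, ← pow_add]
      exact Nat.pow_le_pow_right hp.pos (by omega)
  rcases step d with h | h
  · exact h
  · have : Nat.card (serN N d) ≤ 1 := by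
      have hpos : 0 < p ^ d := pow_pos hp.pos d
      by_contra! hcon
      nlinarith
    exact Subgroup.eq_bot_of_card_le _ this

theorem exists_self_centralizing {p : ℕ} (hp : p.Prime) {K : Type*} [Group K] [Finite K]
    (hK : IsPGroup p K) (M : Subgroup K) [M.Normal] :
    ∃ A : Subgroup K, A.Normal ∧ A ≤ M ∧ (∀ a ∈ A, ∀ b ∈ A, a * b = b * a) ∧
      M ⊓ Subgroup.centralizer (A : Set K) ≤ A := by
  obtain ⟨A, ⟨hAn, hAM, hab⟩, hmax⟩ := Set.Finite.exists_maximal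
    (Set.toFinite {A : Subgroup K | A.Normal ∧ A ≤ M ∧ (∀ a ∈ A, ∀ b ∈ A, a * b = b * a)})
    ⟨⊥, by infer_instance, bot_le, by simp⟩
  refine ⟨A, hAn, hAM, hab, ?_⟩
  by_contra hnot
  set C := M ⊓ Subgroup.centralizer (A : Set K) with hC
  have hCn : C.Normal := by rw [hC]; infer_instance
  have hex : ∃ n, serN C n ≤ A := by
    have : Fact p.Prime := ⟨hp⟩
    obtain ⟨n, hn⟩ := IsPGroup.iff_card.1 (hK.to_subgroup C)
    exact ⟨n, by rw [serN_eq_bot_of_card hp hK C n hn.le]; exact bot_le⟩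
  classical
  obtain ⟨n, hn⟩ : ∃ n, Nat.find hex = n + 1 := by
    refine Nat.exists_eq_succ_of_ne_zero fun h0 => hnot ?_
    have := Nat.find_spec hex
    rw [h0] at this
    exact this
  have h1 : serN C (n + 1) ≤ A := hn ▸ Nat.find_spec hex
  have h2 : ¬ serN C n ≤ A := Nat.find_min hex (by omega)
  obtain ⟨b, hb, hbA⟩ := SetLike.not_le_iff_exists.1 h2
  have hbC : b ∈ C := serN_anti C (Nat.zero_le n) hb
  have hcomm : ∀ g : K, ⁅b, g⁆ ∈ A := fun g =>
    h1 (Subgroup.commutator_mem_commutator hb (Subgroup.mem_top g))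
  have hbc : ∀ a ∈ A, a * b = b * a := fun a ha => Subgroup.mem_centralizer_iff.1 hbC.2 a ha
  let B := A ⊔ Subgroup.zpowers b
  have hBmem : B ∈ {A : Subgroup K | A.Normal ∧ A ≤ M ∧ (∀ a ∈ A, ∀ b ∈ A, a * b = b * a)} := by
    refine ⟨?_, ?_, ?_⟩
    · rw [← Subgroup.commutator_top_right_le_iff, Subgroup.commutator_le]
      intro x hx g _
      apply (le_sup_left : A ≤ B)
      obtain ⟨a, ha, z, hz, rfl⟩ := Subgroup.mem_sup_of_normal_left.1 hx
      obtain ⟨k, rfl⟩ := hz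
      have hk : ((⁅b ^ k, g⁆ : K)) ∈ A := by
        have e : ∀ y : K, ⁅y, g⁆ ∈ A ↔ (QuotientGroup.mk' A y) * (QuotientGroup.mk' A g)
            = (QuotientGroup.mk' A g) * (QuotientGroup.mk' A y) := by
          intro y
          rw [← commutatorElement_eq_one_iff_mul_comm, ← map_commutatorElement,
            ← MonoidHom.mem_ker, QuotientGroup.ker_mk']
        rw [e, map_zpow]
        exact (show Commute _ _ from (e b).1 (hcomm g)).zpow_left k
      have ha' : ⁅a, g⁆ ∈ A :=
        Subgroup.commutator_le_left A ⊤
          (Subgroup.commutator_mem_commutator ha (Subgroup.mem_top g))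
      have := mul_mem (hAn.conj_mem _ hk a) ha'
      convert this using 1
      simp only [commutatorElement_def]; group
    · exact sup_le hAM ((Subgroup.zpowers_le).2 hbC.1)
    · intro x hx y hy
      obtain ⟨a, ha, z, ⟨k, rfl⟩, rfl⟩ := Subgroup.mem_sup_of_normal_left.1 hx
      obtain ⟨a', ha', z', ⟨k', rfl⟩, rfl⟩ := Subgroup.mem_sup_of_normal_left.1 hy
      have c1 : Commute a a' := hab a ha a' ha'
      have c2 : Commute a (b ^ k') := (show Commute a b from hbc a ha).zpow_right k'
      have c3 : Commute a' (b ^ k) := (show Commute a' b from hbc a' ha').zpow_right k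
      have c4 : Commute (b ^ k) (b ^ k') := (Commute.refl b).zpow_zpow k k'
      exact ((c1.mul_right c2).mul_left (c3.symm.mul_right c4))
  have := hmax hBmem (le_sup_left : A ≤ B)
  exact hbA (this ((le_sup_right : _ ≤ B) (Subgroup.mem_zpowers b)))

theorem class_bound {p d : ℕ} (hp : p.Prime) {K : Type*} [Group K] [Finite K]
    (hK : IsPGroup p K) (hd : 2 ≤ d) (hr : RankLE d K)
    (hexp : ∀ c ∈ commutator K, c ^ p = 1) : serN (⊤ : Subgroup K) (2 * d - 1) = ⊥ := by
  obtain ⟨A, hAn, hAM, hab, hcent⟩ := exists_self_centralizing hp hK (commutator K)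
  have hcard := card_le_of_rankLE hp.pos hr A hab (fun a ha => hexp a (hAM ha))
  have hbot := serN_eq_bot_of_card hp hK A d hcard
  have h1 : serN (⊤ : Subgroup K) (d - 1) ≤ A := by
    refine le_trans (le_inf ?_ ?_) hcent
    · have : serN (⊤ : Subgroup K) (d - 1) ≤ serN (⊤ : Subgroup K) 1 := serN_anti ⊤ (by omega)
      exact this
    · rw [← Subgroup.commutator_eq_bot_iff_le_centralizer, Subgroup.commutator_comm, eq_bot_iff]
      have := serN_comm A (d - 1) 0
      rw [show 0 + (d - 1) + 1 = d by omega, hbot] at this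
      exact this
  rw [show 2 * d - 1 = (d - 1) + d by omega, serN_add, eq_bot_iff, ← hbot]
  exact serN_mono h1 d

theorem dG_spec {d : ℕ} {G : Type*} [Group G] [Finite G] (h : dG G ≤ d) :
    ∃ S : Finset G, S.card ≤ d ∧ Subgroup.closure (S : Set G) = ⊤ := by
  have hne : {n | ∃ S : Finset G, S.card = n ∧ Subgroup.closure (S : Set G) = ⊤}.Nonempty := by
    have := Fintype.ofFinite G
    exact ⟨_, Finset.univ, rfl, by simp⟩
  obtain ⟨S, hS, hc⟩ := Nat.sInf_mem hne
  exact ⟨S, hS.le.trans h, hc⟩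

theorem rankLE_of_dG {d : ℕ} {P : Type*} [Group P] [Finite P]
    (h : ∀ H : Subgroup P, dG H ≤ d) : RankLE d P := by
  classical
  intro A
  obtain ⟨S, hS, hc⟩ := dG_spec (h A)
  refine ⟨S.image A.subtype, Finset.card_image_le.trans hS, ?_⟩
  rw [Finset.coe_image, ← MonoidHom.map_closure, hc, ← MonoidHom.range_eq_map,
    Subgroup.range_subtype]

theorem regular_of_rankLE {p d : ℕ} (hp : p.Prime) {P : Type*} [Group P] [Finite P]
    (hP : IsPGroup p P) (hr : RankLE d P) (hpd : 2 * d ≤ p) : IsRegularPGroup p P := by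
  classical
  intro x y
  rcases Nat.lt_or_ge d 2 with hd | hd
  · obtain ⟨S, hS, hc⟩ := hr ⊤
    obtain ⟨z, hz⟩ := Finset.card_le_one_iff_subset_singleton.1 (show S.card ≤ 1 by omega)
    have hall : ∀ g : P, g ∈ Subgroup.zpowers z := by
      intro g
      rw [Subgroup.zpowers_eq_closure]
      refine Subgroup.closure_mono (show (S : Set P) ⊆ {z} by exact_mod_cast hz) ?_
      rw [hc]; trivial
    have hxy : Commute x y := by
      obtain ⟨a, rfl⟩ := hall x
      obtain ⟨b, rfl⟩ := hall y
      exact (Commute.refl z).zpow_zpow a b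
    rw [hxy.mul_pow, mul_inv_cancel]
    exact one_mem _
  · set H := Subgroup.closure {x, y} with hH
    have hx : x ∈ H := Subgroup.subset_closure (by simp)
    have hy : y ∈ H := Subgroup.subset_closure (by simp)
    let U : Subgroup H := Subgroup.closure ((· ^ p) '' (commutator H : Set H))
    have hUn : U.Normal := by
      constructor
      intro n hn g
      have hmap : U.map (MulAut.conj g).toMonoidHom ≤ U := by
        rw [MonoidHom.map_closure, Subgroup.closure_le]
        rintro _ ⟨_, ⟨c, hc, rfl⟩, rfl⟩
        refine Subgroup.subset_closure ⟨g * c * g⁻¹, ?_, ?_⟩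
        · exact Subgroup.Normal.conj_mem inferInstance c hc g
        · simp [conj_pow]
      exact hmap ⟨n, hn, rfl⟩
    have hsurj := QuotientGroup.mk'_surjective U
    have hexp : ∀ c ∈ commutator (H ⧸ U), c ^ p = 1 := by
      intro c hc
      have : commutator (H ⧸ U) = (commutator H).map (QuotientGroup.mk' U) := by
        rw [commutator_def, commutator_def, Subgroup.map_commutator,
          Subgroup.map_top_of_surjective _ hsurj]
      rw [this] at hc
      obtain ⟨c, hc, rfl⟩ := hc
      rw [← map_pow, ← MonoidHom.mem_ker, QuotientGroup.ker_mk']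
      exact Subgroup.subset_closure ⟨c, hc, rfl⟩
    have hK : IsPGroup p (H ⧸ U) := (hP.to_subgroup H).to_quotient U
    have hrK : RankLE d (H ⧸ U) := (hr.subgroup H).of_surjective _ hsurj
    have hcl := class_bound hp hK hd hrK hexp
    have hcl' : serN (⊤ : Subgroup (H ⧸ U)) (p - 1) = ⊥ := by
      rw [eq_bot_iff, ← hcl]
      exact serN_anti ⊤ (by omega)
    have hmul := mul_pow_of_class_lt p hp hcl' hexp
      (QuotientGroup.mk' U ⟨x, hx⟩) (QuotientGroup.mk' U ⟨y, hy⟩)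
    rw [← mul_inv_eq_one, ← map_mul, ← map_pow, ← map_pow, ← map_pow, ← map_mul, ← map_inv,
      ← map_mul, ← MonoidHom.mem_ker, QuotientGroup.ker_mk'] at hmul
    have hle : U.map H.subtype ≤ Subgroup.closure ((· ^ p) '' (⁅H, H⁆ : Subgroup P)) := by
      rw [MonoidHom.map_closure, Subgroup.closure_le]
      rintro _ ⟨_, ⟨c, hc, rfl⟩, rfl⟩
      refine Subgroup.subset_closure ⟨c.1, ?_, by simp⟩
      have : (commutator H).map H.subtype = ⁅H, H⁆ := by
        rw [commutator_def, Subgroup.map_commutator, ← MonoidHom.range_eq_map,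
          Subgroup.range_subtype]
      rw [← this]
      exact ⟨c, hc, rfl⟩
    have := hle ⟨_, hmul, rfl⟩
    simpa using this

end Aux

/-- If `(P, α)` is a maximal `(p,q)`-pair of rank `d` and `p ≥ 2d`, then `P` is a
regular `p`-group. -/
theorem stmt11 (p q d : ℕ) (P : Type*) [Group P] (α : P ≃* P)
    (h : IsMaximalPair p q d P α) (hp : 2 * d ≤ p) :
    IsRegularPGroup p P := by
  obtain ⟨hpp, _, hfin, hP, _, _, _, hr, _⟩ := h
  exact regular_of_rankLE hpp hP (rankLE_of_dG hr) hp
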